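/- arXiv:1906.11518 — 3 statements merged into one kernel-verified Lean document; each statement's English description precedes it below -/
import Mathlib

section
/- Let A be a finite attribute set, D a type, Ψ a family of nonempty subsets of A with ⋃Ψ = A, and S_U a relation of tuples over U for each U ∈ Ψ. Let A be partitioned into disjoint sets I and J with I ∪ J = A. Define R(I) = { s : I → D | for every U ∈ Ψ with U ∩ I ≠ ∅, there exists r ∈ S_U with r|_(U∩I) = s|_(U∩I) }, and for s : I → D define R_J(s) = { q : J → D | for every U ∈ Ψ with U ∩ J ≠ ∅, there exists r ∈ S_U with r|_(U∩I) = s|_(U∩I) and r|_(U∩J) = q|_(U∩J) }. Then for every t : A → D, t ∈ Join(Ψ, S) if and only if t|_I ∈ R(I) and t|_J ∈ R_J(t|_I). (This is the correctness of one recursive step of the GenericJoin algorithm: the join R(V) equals the union over t_I ∈ R(I) of {t_I} × R(J) w.r.t. t_I.) -/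
/-- Correctness of one recursive step of the GenericJoin algorithm:
a tuple `t` over the full attribute set belongs to the natural join
`Join(Ψ, S)` iff its restriction to `I` belongs to `R(I)` and its
restriction to `J` belongs to `R_J(t|_I)`. -/
theorem genericJoin_step {α D : Type*} [Fintype α]
    (Ψ : Set (Set α))
    (hne : ∀ U ∈ Ψ, U.Nonempty)
    (hcover : ⋃₀ Ψ = Set.univ)
    (S : ∀ U ∈ Ψ, Set (↥U → D))
    (I J : Set α) (hdisj : Disjoint I J) (hunion : I ∪ J = Set.univ)
    (t : α → D) :
    -- t ∈ Join(Ψ, S)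
    (∀ U (hU : U ∈ Ψ), (fun a : ↥U => t a) ∈ S U hU) ↔
      -- t|_I ∈ R(I)
      ((∀ U (hU : U ∈ Ψ), (U ∩ I).Nonempty →
          ∃ r ∈ S U hU, ∀ a : ↥(U ∩ I), r ⟨a.1, a.2.1⟩ = t a.1) ∧
       -- t|_J ∈ R_J(t|_I)
       (∀ U (hU : U ∈ Ψ), (U ∩ J).Nonempty →
          ∃ r ∈ S U hU, (∀ a : ↥(U ∩ I), r ⟨a.1, a.2.1⟩ = t a.1) ∧
            (∀ a : ↥(U ∩ J), r ⟨a.1, a.2.1⟩ = t a.1))) := by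
  have hmem (a : α) : a ∈ I ∨ a ∈ J := by
    have ha : a ∈ I ∪ J := hunion ▸ Set.mem_univ a
    exact ha
  constructor
  · intro h
    exact ⟨fun U hU _ => ⟨_, h U hU, fun _ => rfl⟩,
      fun U hU _ => ⟨_, h U hU, fun _ => rfl, fun _ => rfl⟩⟩
  · rintro ⟨hI, hJ⟩ U hU
    by_cases hUJ : (U ∩ J).Nonempty
    · obtain ⟨r, hr, hrI, hrJ⟩ := hJ U hU hUJ
      have hrt : r = fun a : ↥U => t a := by
        funext a
        rcases hmem a with ha | ha
        · exact hrI ⟨a, a.2, ha⟩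
        · exact hrJ ⟨a, a.2, ha⟩
      exact hrt ▸ hr
    · have hUI (a : α) (ha : a ∈ U) : a ∈ I :=
        (hmem a).resolve_right fun haJ => hUJ ⟨a, ha, haJ⟩
      obtain ⟨b, hb⟩ := hne U hU
      obtain ⟨r, hr, hrI⟩ := hI U hU ⟨b, hb, hUI b hb⟩
      have hrt : r = fun a : ↥U => t a :=
        funext fun a => hrI ⟨a, a.2, hUI a a.2⟩
      exact hrt ▸ hr
end

section
/- Let x ≥ 1 and y ≥ 1, and let Q be a crystal Q(x, y): a finite simple graph whose vertex set is the disjoint union of X with |X| = x and Y with |Y| = y, such that the induced subgraph Q(X) is a complete graph (x-clique), every vertex of X is adjacent to every vertex of Y, and there are no edges between vertices of Y. Let G be a finite simple graph and let f_x : X → V_G be a match of the clique Q(X) in G. Set I_y = ⋂_{a ∈ X} N_G(f_x(a)). Then a map f : V_Q → V_G extending f_x is a match of Q in G if and only if the restriction of f to Y is an injective map with all values in I_y; consequently, the number of matches of Q in G extending f_x equals the descending factorial |I_y|·(|I_y|−1)⋯(|I_y|−y+1). (This is the correctness of CrystalJoin's compressed representation (f_x, I_y) of the matches of a crystal.) 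-/
/-- The crystal `Q(x, y)`: the vertex set is the disjoint union of `X = Fin x`
(the clique vertices, `Sum.inl`) and `Y = Fin y` (the bud vertices, `Sum.inr`);
the induced subgraph on `X` is a complete graph, every vertex of `X` is
adjacent to every vertex of `Y`, and there are no edges inside `Y`. -/
def crystal (x y : ℕ) : SimpleGraph (Fin x ⊕ Fin y) :=
  SimpleGraph.fromRel (fun v _ => v.isLeft)

theorem crystal_adj {x y : ℕ} {v w : Fin x ⊕ Fin y} :
    (crystal x y).Adj v w ↔ v ≠ w ∧ (v.isLeft ∨ w.isLeft) := by
  simp [crystal]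

/-- A map extending a clique match is a crystal match iff its restriction to the buds is injective
with values in the common neighborhood of the clique. -/
theorem crystal_match_iff {β : Type*} {x y : ℕ} {G : SimpleGraph β} {fx : Fin x → β}
    (hinj : Function.Injective fx) (hadj : ∀ a b : Fin x, a ≠ b → G.Adj (fx a) (fx b))
    {f : Fin x ⊕ Fin y → β} (hf : ∀ a : Fin x, f (Sum.inl a) = fx a) :
    (Function.Injective f ∧ ∀ v w, (crystal x y).Adj v w → G.Adj (f v) (f w)) ↔
      (Function.Injective (fun b : Fin y => f (Sum.inr b)) ∧
        ∀ b : Fin y, f (Sum.inr b) ∈ ⋂ a : Fin x, G.neighborSet (fx a)) := by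
  simp only [Set.mem_iInter, SimpleGraph.mem_neighborSet]
  constructor
  · rintro ⟨hi, h⟩
    refine ⟨hi.comp Sum.inr_injective, fun b a => ?_⟩
    rw [← hf a]
    exact h _ _ (crystal_adj.2 (by simp))
  · rintro ⟨hi, h⟩
    constructor
    · rintro (a | a) (b | b) hab
      · rw [hf, hf] at hab
        rw [hinj hab]
      · rw [hf] at hab
        exact absurd hab (h b a).ne
      · rw [hf] at hab
        exact absurd hab.symm (h a b).ne
      · exact congrArg Sum.inr (hi hab)
    · rintro (a | a) (b | b) hab
      · rw [hf, hf]
        exact hadj a b fun e => hab.ne (congrArg Sum.inl e)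
      · rw [hf]
        exact h b a
      · rw [hf]
        exact (h a b).symm
      · simp [crystal_adj] at hab

/-- Maps out of a sum with a prescribed left part, and whose right part is injective with values
in `s`, correspond to embeddings into `s`. -/
def sumExtensionEquivEmbedding {α γ β : Type*} (g : α → β) (s : Set β) :
    {f : α ⊕ γ → β // (∀ a, f (Sum.inl a) = g a) ∧
      Function.Injective (fun b => f (Sum.inr b)) ∧ ∀ b, f (Sum.inr b) ∈ s} ≃ (γ ↪ s) where
  toFun f := ⟨fun b => ⟨f.1 (Sum.inr b), f.2.2.2 b⟩,
    fun _ _ h => f.2.2.1 (congrArg Subtype.val h)⟩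
  invFun e := ⟨Sum.elim g fun b => e b, fun _ => rfl,
    fun _ _ h => e.injective (Subtype.ext h), fun b => (e b).2⟩
  left_inv f := by
    ext (a | b)
    · exact (f.2.1 a).symm
    · rfl
  right_inv _ := rfl

/-- Correctness of CrystalJoin's compressed representation `(f_x, I_y)`:
given a match `f_x` of the clique `Q(X)` in `G`, with
`I_y = ⋂_{a ∈ X} N_G(f_x(a))`, a map `f` extending `f_x` is a match of the
crystal iff its restriction to `Y` is injective with all values in `I_y`;
consequently the number of matches extending `f_x` is the descending factorial
`|I_y|(|I_y|-1)⋯(|I_y|-y+1)`. -/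
theorem crystalJoin_compression_correct {β : Type*} [Fintype β]
    (x y : ℕ) (hx : 1 ≤ x) (hy : 1 ≤ y)
    (G : SimpleGraph β) (fx : Fin x → β)
    (hfx : Function.Injective fx ∧ ∀ a b : Fin x, a ≠ b → G.Adj (fx a) (fx b)) :
    (∀ f : Fin x ⊕ Fin y → β, (∀ a : Fin x, f (Sum.inl a) = fx a) →
      ((Function.Injective f ∧
          ∀ v w, (crystal x y).Adj v w → G.Adj (f v) (f w)) ↔
        (Function.Injective (fun b : Fin y => f (Sum.inr b)) ∧
          ∀ b : Fin y, f (Sum.inr b) ∈ ⋂ a : Fin x, G.neighborSet (fx a)))) ∧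
    Nat.card {f : Fin x ⊕ Fin y → β //
        (∀ a : Fin x, f (Sum.inl a) = fx a) ∧
        Function.Injective f ∧
        ∀ v w, (crystal x y).Adj v w → G.Adj (f v) (f w)} =
      Nat.descFactorial
        (Nat.card (⋂ a : Fin x, G.neighborSet (fx a) : Set β)) y := by
  refine ⟨fun f hf => crystal_match_iff hfx.1 hfx.2 hf, ?_⟩
  classical
  rw [Nat.card_congr ((Equiv.subtypeEquivRight fun f =>
      and_congr_right fun hf => crystal_match_iff hfx.1 hfx.2 hf).trans
        (sumExtensionEquivEmbedding fx _)),
    Nat.card_eq_fintype_card, Nat.card_eq_fintype_card, Fintype.card_embedding_eq,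
    Fintype.card_fin]
end

section
/- Let Q and G be finite simple graphs, and let W ⊆ V_Q be an independent set in Q (no edge of Q joins two vertices of W). Then a map f : V_Q → V_G is a match of Q in G if and only if: (i) the restriction of f to V_Q \ W is a match of the induced subgraph Q(V_Q \ W) in G; (ii) for every w ∈ W, f(w) ∈ ⋂_{x ∈ N_Q(w)} N_G(f(x)); and (iii) f is injective on W and f(W) is disjoint from f(V_Q \ W). (This is the correctness of the Compression optimization: vertices whose matches are not used in any future computation can be kept compressed as intersections of the already-matched vertices' neighbor sets.) -/
/-- Correctness of the Compression optimization: if `W` is an independent set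
of the query graph `Q`, then `f : V_Q → V_G` is a match of `Q` in `G` iff
(i) its restriction to `V_Q \ W` is a match of the induced subgraph
`Q(V_Q \ W)` in `G`, (ii) every `w ∈ W` is mapped into the intersection of the
`G`-neighborhoods of the images of `w`'s `Q`-neighbors, and (iii) `f` is
injective on `W` with `f(W)` disjoint from `f(V_Q \ W)`. -/
theorem compression_correct {α β : Type*} [Fintype α] [Fintype β]
    (Q : SimpleGraph α) (G : SimpleGraph β) (W : Set α)
    (hW : ∀ v ∈ W, ∀ w ∈ W, ¬ Q.Adj v w)
    (f : α → β) :
    -- f is a match of Q in G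
    (Function.Injective f ∧ ∀ v w : α, Q.Adj v w → G.Adj (f v) (f w)) ↔
      -- (i) f restricted to V_Q \ W is a match of Q(V_Q \ W) in G
      ((Set.InjOn f Wᶜ ∧
          ∀ v ∈ Wᶜ, ∀ w ∈ Wᶜ, Q.Adj v w → G.Adj (f v) (f w)) ∧
       -- (ii) each w ∈ W is mapped into ⋂_{x ∈ N_Q(w)} N_G(f x)
       (∀ w ∈ W, f w ∈ ⋂ x ∈ Q.neighborSet w, G.neighborSet (f x)) ∧
       -- (iii) f is injective on W and f(W) is disjoint from f(V_Q \ W)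
       (Set.InjOn f W ∧ Disjoint (f '' W) (f '' Wᶜ))) := by
  constructor
  · rintro ⟨hinj, hadj⟩
    refine ⟨⟨hinj.injOn, fun v _ w _ => hadj v w⟩, fun w _ => ?_, hinj.injOn, ?_⟩
    · simp only [Set.mem_iInter, SimpleGraph.mem_neighborSet]
      exact fun x hx => (hadj w x hx).symm
    · exact (Set.disjoint_image_iff hinj).2 disjoint_compl_right
  · rintro ⟨⟨hinj_compl, hadj⟩, hnbr, hinj, hdisj⟩
    simp only [Set.mem_iInter, SimpleGraph.mem_neighborSet] at hnbr
    have hne : ∀ v ∈ W, ∀ w ∉ W, f v ≠ f w := fun v hv w hw =>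
      Set.disjoint_iff_forall_ne.1 hdisj (Set.mem_image_of_mem f hv)
        (Set.mem_image_of_mem f hw)
    refine ⟨fun v w h => ?_, fun v w h => ?_⟩
    · by_cases hv : v ∈ W <;> by_cases hw : w ∈ W
      · exact hinj hv hw h
      · exact (hne v hv w hw h).elim
      · exact (hne w hw v hv h.symm).elim
      · exact hinj_compl hv hw h
    · by_cases hv : v ∈ W
      · exact (hnbr v hv w h).symm
      · by_cases hw : w ∈ W
        · exact hnbr w hw v h.symm
        · exact hadj v hv w hw h
end
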